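/- arXiv:1711.02813 — 5 statements merged into one kernel-verified Lean document; each statement's English description precedes it below -/
import Mathlib

section
/- Let α > 0, β ≥ 0, h > 0 and let Q, V be real numbers with V > 0 (V = ‖Ω‖ is the reservoir volume). Let W̄ : ℝ → ℝ be differentiable, and define v₁(x,y) = −f_{α,β}(|W̄′(x)|)·W̄′(x) (independent of y), where f_{α,β}(ζ) = 2/(α + √(α² + 4βζ)). Fix x ∈ ℝ and assume: (i) the function u(s) = f_{α,β}(|W̄′(s)|)·W̄′(s) is differentiable at x; (ii) the function y ↦ v₂(x,y) is differentiable on [−h/2, h/2] with derivative ∂_y v₂(x,·) interval-integrable on [−h/2, h/2]; (iii) the continuity equation ∂_x v₁(x,y) + ∂_y v₂(x,y) = Q/V holds for every y ∈ [−h/2, h/2]. Then −(Q/V)·h = h·u′(x) − (v₂(x, h/2) − v₂(x, −h/2)). -/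
/-- The Forchheimer nonlinearity `f_{α,β}(ζ) = 2/(α + √(α² + 4βζ))`. -/
noncomputable def forchheimerF (α β ζ : ℝ) : ℝ :=
  2 / (α + Real.sqrt (α ^ 2 + 4 * β * ζ))

/-- integrating the continuity equation across the fracture
thickness yields the reduced 1-D equation
`−(Q/V)h = h u′(x) − (v₂(x,h/2) − v₂(x,−h/2))`,
where `u(s) = f_{α,β}(|W̄′(s)|) W̄′(s)` and `v₁(x,y) = −u(x)`. -/
theorem fracture_model_reduction
    (α β h Q V : ℝ) (hα : 0 < α) (hβ : 0 ≤ β) (hh : 0 < h) (hV : 0 < V)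
    (Wbar : ℝ → ℝ) (hWbar : Differentiable ℝ Wbar)
    (v₁ : ℝ → ℝ → ℝ)
    (hv₁ : ∀ x y, v₁ x y = -(forchheimerF α β |deriv Wbar x| * deriv Wbar x))
    (v₂ : ℝ → ℝ → ℝ)
    (u : ℝ → ℝ)
    (hu : ∀ s, u s = forchheimerF α β |deriv Wbar s| * deriv Wbar s)
    (x : ℝ)
    (hu_diff : DifferentiableAt ℝ u x)
    (hv₂_diff : ∀ y ∈ Set.Icc (-(h / 2)) (h / 2), DifferentiableAt ℝ (v₂ x) y)
    (hv₂_int : IntervalIntegrable (fun y => deriv (v₂ x) y)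
      MeasureTheory.volume (-(h / 2)) (h / 2))
    (hcont : ∀ y ∈ Set.Icc (-(h / 2)) (h / 2),
      deriv (fun s => v₁ s y) x + deriv (v₂ x) y = Q / V) :
    -(Q / V) * h = h * deriv u x - (v₂ x (h / 2) - v₂ x (-(h / 2))) := by
  have hv₁_eq (y : ℝ) : (fun s => v₁ s y) = fun s => -u s :=
    funext fun s => by rw [hv₁, hu]
  have hv₂_deriv : ∀ y ∈ Set.Icc (-(h / 2)) (h / 2),
      deriv (v₂ x) y = Q / V + deriv u x := fun y hy => by
    have hy_cont := hcont y hy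
    rw [hv₁_eq, deriv.fun_neg] at hy_cont
    linarith
  have hIcc : Set.uIcc (-(h / 2)) (h / 2) = Set.Icc (-(h / 2)) (h / 2) :=
    Set.uIcc_of_le (by linarith)
  have hjump := intervalIntegral.integral_deriv_eq_sub (hIcc ▸ hv₂_diff) hv₂_int
  rw [intervalIntegral.integral_congr (hIcc ▸ hv₂_deriv),
    intervalIntegral.integral_const, smul_eq_mul] at hjump
  rw [← hjump]
  ring
end

section
/- Let α > 0 and β ≥ 0, and define f_{α,β}(ζ) = 2/(α + √(α² + 4βζ)) for ζ ≥ 0. Then for all real numbers η₁, η₂: ( f_{α,β}(|η₁|)·η₁ − f_{α,β}(|η₂|)·η₂ )·(η₁ − η₂) ≥ (1/2)·f_{α,β}( max(|η₁|, |η₂|) )·(η₁ − η₂)². -/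
lemma forchheimerF_nonneg {α : ℝ} (hα : 0 < α) (β ζ : ℝ) : 0 ≤ forchheimerF α β ζ := by
  unfold forchheimerF
  positivity

lemma forchheimerF_le_of_le {α β x y : ℝ} (hα : 0 < α) (hβ : 0 ≤ β) (hxy : x ≤ y) :
    forchheimerF α β y ≤ forchheimerF α β x := by
  unfold forchheimerF
  gcongr

lemma forchheimerF_sub_mul_le {α β x y : ℝ} (hα : 0 < α) (hβ : 0 ≤ β) (hx : 0 ≤ x)
    (hxy : x ≤ y) :
    (forchheimerF α β x - forchheimerF α β y) * x ≤
      (1 / 2) * forchheimerF α β y * (y - x) := by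
  have hpq : √(α ^ 2 + 4 * β * x) ≤ √(α ^ 2 + 4 * β * y) := by gcongr
  have hy : 0 ≤ y := hx.trans hxy
  have hq2 : √(α ^ 2 + 4 * β * x) ^ 2 = α ^ 2 + 4 * β * x := Real.sq_sqrt (by positivity)
  have hp2 : √(α ^ 2 + 4 * β * y) ^ 2 = α ^ 2 + 4 * β * y := Real.sq_sqrt (by positivity)
  have hq : 0 < √(α ^ 2 + 4 * β * x) := by positivity
  unfold forchheimerF
  generalize √(α ^ 2 + 4 * β * x) = q at *
  generalize √(α ^ 2 + 4 * β * y) = p at *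
  have hp : 0 < p := hq.trans_le hpq
  have hslope : 8 * β * x ≤ (α + q) * (p + q) := by
    nlinarith [mul_nonneg (add_pos hα hq).le (sub_nonneg.2 hpq), mul_pos hα hq]
  have key : 2 * (p - q) * x ≤ (α + q) * (y - x) := by
    refine le_of_mul_le_mul_right ?_ (add_pos hp hq)
    calc 2 * (p - q) * x * (p + q) = 8 * β * x * (y - x) := by
          linear_combination 2 * x * hp2 - 2 * x * hq2
      _ ≤ (α + q) * (p + q) * (y - x) :=
          mul_le_mul_of_nonneg_right hslope (sub_nonneg.2 hxy)
      _ = (α + q) * (y - x) * (p + q) := by ring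
  have hdiff : (1 / 2) * (2 / (α + p)) * (y - x) - (2 / (α + q) - 2 / (α + p)) * x =
      ((α + q) * (y - x) - 2 * (p - q) * x) / ((α + p) * (α + q)) := by
    field_simp
    ring
  rw [← sub_nonneg, hdiff]
  exact div_nonneg (sub_nonneg.2 key) (by positivity)

lemma forchheimerF_monotone_of_abs_le {α β a b : ℝ} (hα : 0 < α) (hβ : 0 ≤ β)
    (hab : |b| ≤ |a|) :
    (1 / 2) * forchheimerF α β |a| * (a - b) ^ 2 ≤
      (forchheimerF α β |a| * a - forchheimerF α β |b| * b) * (a - b) := by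
  have hF := forchheimerF_nonneg hα β |a|
  have hFG := sub_nonneg.2 (forchheimerF_le_of_le hα hβ hab)
  have hkey := mul_le_mul_of_nonneg_right
    (forchheimerF_sub_mul_le hα hβ (abs_nonneg b) hab) (sub_nonneg.2 hab)
  have hprod : a * b ≤ |a| * |b| := (le_abs_self _).trans_eq (abs_mul a b)
  have hb : b * (a - b) ≤ |b| * (|a| - |b|) := by
    linarith [sq_abs b]
  have hsq : (|a| - |b|) ^ 2 ≤ (a - b) ^ 2 := by
    linarith [sq_abs a, sq_abs b]
  linarith [mul_le_mul_of_nonneg_left hb hFG, mul_le_mul_of_nonneg_left hsq hF]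

/-- Lemma 3.5, NSM: quantitative strict monotonicity of
`η ↦ f_{α,β}(|η|) η`. -/
theorem forchheimer_scalar_monotone
    (α β : ℝ) (hα : 0 < α) (hβ : 0 ≤ β) (η₁ η₂ : ℝ) :
    (forchheimerF α β |η₁| * η₁ - forchheimerF α β |η₂| * η₂) * (η₁ - η₂) ≥
      (1 / 2) * forchheimerF α β (max |η₁| |η₂|) * (η₁ - η₂) ^ 2 := by
  rcases le_total |η₂| |η₁| with h | h
  · rw [max_eq_left h]
    exact forchheimerF_monotone_of_abs_le hα hβ h
  · rw [max_eq_right h]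
    linarith [forchheimerF_monotone_of_abs_le hα hβ h]
end

section
/- Define g : ℝ → ℝ by g(u) = (√(1 + |u|) − 1)·sign(u), where sign(u) = 1 if u > 0, −1 if u < 0 and 0 if u = 0. Then for all real u, v with max(|u|, |v|) ≥ 24: (g(u) − g(v))² ≥ ( √(|u|/2)·sign(u) − √(|v|/2)·sign(v) )². -/
/-- The function `g(u) = (√(1+|u|) − 1)·sign(u)`. -/
noncomputable def gFun (u : ℝ) : ℝ :=
  (Real.sqrt (1 + |u|) - 1) * Real.sign u

/-- For `a ≥ 24` and `0 ≤ b ≤ a`, the value of `x ↦ √(1+x) - 1 - √(x/2)` at `a` dominates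
its absolute value at `b`. -/
theorem abs_sqrt_one_add_sub_sqrt_half_le {a b : ℝ} (ha : 24 ≤ a) (hb : 0 ≤ b) (hba : b ≤ a) :
    |√(1 + b) - 1 - √(b / 2)| ≤ √(1 + a) - 1 - √(a / 2) := by
  have hs : √(1 + a) ^ 2 = 1 + a := Real.sq_sqrt (by linarith)
  have ht : √(1 + b) ^ 2 = 1 + b := Real.sq_sqrt (by linarith)
  have hp : √(a / 2) ^ 2 = a / 2 := Real.sq_sqrt (by linarith)
  have hq : √(b / 2) ^ 2 = b / 2 := Real.sq_sqrt (by linarith)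
  have hqp : √(b / 2) ≤ √(a / 2) := Real.sqrt_le_sqrt (by linarith)
  have hs0 := Real.sqrt_nonneg (1 + a)
  have ht0 := Real.sqrt_nonneg (1 + b)
  have hp0 := Real.sqrt_nonneg (a / 2)
  have hq0 := Real.sqrt_nonneg (b / 2)
  generalize √(1 + a) = s at *
  generalize √(1 + b) = t at *
  generalize √(a / 2) = p at *
  generalize √(b / 2) = q at *
  have hp34 : 3.4 ≤ p := by nlinarith
  have hsp : p + 1.3 ≤ s := abs_le_of_sq_le_sq' (by nlinarith) hs0 |>.2
  have htq : q + 0.7 ≤ t :=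
    abs_le_of_sq_le_sq' (by nlinarith [sq_nonneg (q - 0.7)]) ht0 |>.2
  refine abs_le.2 ⟨by linarith, ?_⟩
  rcases le_total q 1 with hq1 | hq1
  · have : t ≤ q + 1.3 := abs_le_of_sq_le_sq' (by nlinarith) (by linarith) |>.2
    linarith
  · have ht2 : t ≤ 2 * q := abs_le_of_sq_le_sq' (by nlinarith) (by linarith) |>.2
    have hs2 : s ≤ 2 * p := abs_le_of_sq_le_sq' (by nlinarith) (by linarith) |>.2
    have hdiff : (s - t) * (s + t) = 2 * (p - q) * (p + q) := by linarith
    have : (p - q) * (s + t) ≤ (s - t) * (s + t) := by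
      nlinarith [mul_nonneg (sub_nonneg.2 hqp) (by linarith : 0 ≤ 2 * (p + q) - (s + t))]
    linarith [le_of_mul_le_mul_right this (by linarith)]

/-- The inequality `gFun_sq_diff_ge` when `u` is the argument of larger absolute value. -/
theorem gFun_sq_diff_ge_of_abs_le {u v : ℝ} (hu : 24 ≤ |u|) (hvu : |v| ≤ |u|) :
    (√(|u| / 2) * Real.sign u - √(|v| / 2) * Real.sign v) ^ 2 ≤ (gFun u - gFun v) ^ 2 := by
  obtain ⟨hadd, hsub⟩ := abs_le.1 (abs_sqrt_one_add_sub_sqrt_half_le hu (abs_nonneg v) hvu)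
  have hqp : √(|v| / 2) ≤ √(|u| / 2) := Real.sqrt_le_sqrt (by linarith)
  have hq0 := Real.sqrt_nonneg (|v| / 2)
  have hu0 : u ≠ 0 := by
    rintro rfl
    norm_num at hu
  unfold gFun
  generalize √(1 + |u|) = s at *
  generalize √(1 + |v|) = t at *
  generalize √(|u| / 2) = p at *
  generalize √(|v| / 2) = q at *
  have same : (p - q) ^ 2 ≤ ((s - 1) - (t - 1)) ^ 2 :=
    pow_le_pow_left₀ (by linarith) (by linarith) 2
  have opposite : (p + q) ^ 2 ≤ ((s - 1) + (t - 1)) ^ 2 :=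
    pow_le_pow_left₀ (by linarith) (by linarith) 2
  have zero : p ^ 2 ≤ (s - 1) ^ 2 := pow_le_pow_left₀ (by linarith) (by linarith) 2
  rcases Real.sign_apply_eq_of_ne_zero u hu0 with h | h <;>
    rcases Real.sign_apply_eq v with h' | h' | h' <;> rw [h, h'] <;> linarith

/-- Lemma 3.6, second part: for `max(|u|,|v|) ≥ 24`,
`(g(u) − g(v))² ≥ (√(|u|/2) sign u − √(|v|/2) sign v)²`. -/
theorem gFun_sq_diff_ge (u v : ℝ) (h : 24 ≤ max |u| |v|) :
    (gFun u - gFun v) ^ 2 ≥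
      (Real.sqrt (|u| / 2) * Real.sign u - Real.sqrt (|v| / 2) * Real.sign v) ^ 2 := by
  rcases le_total |v| |u| with hvu | huv
  · exact gFun_sq_diff_ge_of_abs_le (by rwa [max_eq_left hvu] at h) hvu
  · rw [ge_iff_le, sub_sq_comm, sub_sq_comm (gFun u)]
    exact gFun_sq_diff_ge_of_abs_le (by rwa [max_eq_right huv] at h) huv
end

section
/- Let α > 0 and β > 0, and define f_{α,β}(ζ) = 2/(α + √(α² + 4βζ)) for ζ ≥ 0. Then for all real numbers u, v with max(|u|, |v|) ≤ 6α²/β: ( f_{α,β}(|u|)·u − f_{α,β}(|v|)·v )·(u − v) ≥ (1/(6α))·(u − v)². -/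
/-- The Forchheimer velocity `w = f(|u|) u` satisfies `β |w| = (√(α² + 4β|u|) - α) / 2`. -/
lemma mul_abs_forchheimerF_mul {α β : ℝ} (hα : 0 < α) (hβ : 0 < β) (u : ℝ) :
    β * |forchheimerF α β |u| * u| = (Real.sqrt (α ^ 2 + 4 * β * |u|) - α) / 2 := by
  have hs := Real.sq_sqrt (show 0 ≤ α ^ 2 + 4 * β * |u| by positivity)
  have hF : 0 ≤ forchheimerF α β |u| := by unfold forchheimerF; positivity
  rw [abs_mul, abs_of_nonneg hF, forchheimerF]
  have : 0 < α + Real.sqrt (α ^ 2 + 4 * β * |u|) := by positivity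
  generalize Real.sqrt (α ^ 2 + 4 * β * |u|) = s at *
  field_simp
  linarith

/-- The Forchheimer velocity `w = f(|u|) u` solves `(α + β |w|) w = u`. -/
lemma forchheimerF_mul_solves {α β : ℝ} (hα : 0 < α) (hβ : 0 < β) (u : ℝ) :
    (α + β * |forchheimerF α β |u| * u|) * (forchheimerF α β |u| * u) = u := by
  rw [mul_abs_forchheimerF_mul hα hβ, forchheimerF]
  have : 0 < α + Real.sqrt (α ^ 2 + 4 * β * |u|) := by positivity
  field_simp
  ring

lemma mul_abs_forchheimerF_mul_le {α β : ℝ} (hα : 0 < α) (hβ : 0 < β) {u : ℝ}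
    (hu : |u| ≤ 6 * α ^ 2 / β) : β * |forchheimerF α β |u| * u| ≤ 2 * α := by
  rw [mul_abs_forchheimerF_mul hα hβ]
  rw [le_div_iff₀ hβ] at hu
  have : Real.sqrt (α ^ 2 + 4 * β * |u|) ≤ 5 * α :=
    Real.sqrt_le_iff.mpr ⟨by positivity, by nlinarith⟩
  linarith

/-- The map `x ↦ |x| x` is monotone, and Lipschitz with constant `2 M` on `[-M, M]`. -/
lemma abs_mul_self_sub_bounds {x y M : ℝ} (hx : |x| ≤ M) (hy : |y| ≤ M) (hxy : y ≤ x) :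
    0 ≤ |x| * x - |y| * y ∧ |x| * x - |y| * y ≤ 2 * M * (x - y) := by
  rcases abs_cases x with ⟨ex, h1⟩ | ⟨ex, h1⟩ <;> rcases abs_cases y with ⟨ey, h2⟩ | ⟨ey, h2⟩ <;>
    rw [ex] at hx ⊢ <;> rw [ey] at hy ⊢ <;> constructor <;> nlinarith

/-- inequality (less): for `max(|u|,|v|) ≤ 6α²/β`,
`(f(|u|)u − f(|v|)v)(u − v) ≥ (1/(6α))(u − v)²`. -/
theorem forchheimer_diff_small (α β : ℝ) (hα : 0 < α) (hβ : 0 < β) (u v : ℝ)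
    (h : max |u| |v| ≤ 6 * α ^ 2 / β) :
    (forchheimerF α β |u| * u - forchheimerF α β |v| * v) * (u - v) ≥
      (1 / (6 * α)) * (u - v) ^ 2 := by
  obtain ⟨hu, hv⟩ := max_le_iff.mp h
  have hw := mul_abs_forchheimerF_mul_le hα hβ hu
  have hz := mul_abs_forchheimerF_mul_le hα hβ hv
  have hwu := forchheimerF_mul_solves hα hβ u
  have hzv := forchheimerF_mul_solves hα hβ v
  generalize forchheimerF α β |u| * u = w at *
  generalize forchheimerF α β |v| * v = z at *
  clear h hu hv
  rw [ge_iff_le, one_div_mul_eq_div, div_le_iff₀ (by positivity)]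
  wlog hzw : z ≤ w generalizing u v w z
  · linarith [this v u z hz hzv w hw hwu (le_of_not_ge hzw)]
  have key := abs_mul_self_sub_bounds (x := β * w) (y := β * z) (M := 2 * α)
    (by rwa [abs_mul, abs_of_pos hβ]) (by rwa [abs_mul, abs_of_pos hβ]) (by gcongr)
  rw [abs_mul, abs_mul, abs_of_pos hβ] at key
  have hlow : 0 ≤ u - v - α * (w - z) := by
    refine nonneg_of_mul_nonneg_right (a := β) ?_ hβ
    linear_combination key.1 + β * hwu - β * hzv
  have hup : u - v ≤ 5 * α * (w - z) := by
    refine le_of_mul_le_mul_left ?_ hβ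
    linear_combination key.2 - β * hwu + β * hzv
  have hd : 0 ≤ α * (w - z) := mul_nonneg hα.le (sub_nonneg.mpr hzw)
  nlinarith
end

section
/- Let E be a real vector space, let A : E → E be an injective linear map, let F : E → E be an arbitrary function, let C : E → ℝ be a linear map, let B ∈ E and y_r ∈ ℝ. Suppose X, z, z̃ ∈ E satisfy the set-point control system: A X + B = 0, A z + F z + γ·B = 0, and A z̃ + F z = 0, where γ = (y_r − C z̃)/(C X), and suppose C X ≠ 0. Then C z = y_r. -/
/-- set point control lemma: if `A X + B = 0`,
`A z + F z + γ • B = 0` and `A z̃ + F z = 0` with `γ = (y_r − C z̃)/(C X)` and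
`C X ≠ 0`, then the output satisfies `C z = y_r`. -/
theorem set_point_control
    {E : Type*} [AddCommGroup E] [Module ℝ E]
    (A : E →ₗ[ℝ] E) (hA : Function.Injective A)
    (F : E → E) (C : E →ₗ[ℝ] ℝ) (B : E) (yr : ℝ)
    (X z ztilde : E) (γ : ℝ)
    (hγ : γ = (yr - C ztilde) / (C X))
    (hX : A X + B = 0)
    (hz : A z + F z + γ • B = 0)
    (hzt : A ztilde + F z = 0)
    (hCX : C X ≠ 0) :
    C z = yr := by
  have hsplit : z = ztilde + γ • X := by
    apply hA
    rw [map_add, map_smul, eq_neg_of_add_eq_zero_left hX, eq_neg_of_add_eq_zero_left hzt,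
      smul_neg, ← neg_add]
    exact eq_neg_of_add_eq_zero_left (by rwa [← add_assoc])
  rw [hsplit, map_add, map_smul, smul_eq_mul, hγ, div_mul_cancel₀ _ hCX]
  ring
end
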